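/- Let κ be a regular uncountable cardinal, λ ≥ κ a cardinal, and d a P_κλ-list. Then d splits every unbounded subset of P_κλ into covering sets if and only if d does not cohere on an unbounded set with a continuous delay function, i.e., there is no set B ⊆ λ, unbounded set U ⊆ P_κλ, and function g : λ → λ such that for every x ∈ P_κλ and every y ∈ U with x ∪ g[x] ⊆ y, B ∩ x = d_y ∩ x. -/

import Mathlib

open Cardinal Set

/-- `P_κλ`: the collection of subsets of `λ` of size less than `κ`. -/
def Pkl (κ lam : Cardinal) : Set (Set Ordinal) :=
  {x | x ⊆ Set.Iio lam.ord ∧ Cardinal.mk ↥x < Cardinal.lift.{1,0} κ}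

/-- `U` is an unbounded (cofinal) subset of `P_κλ`. -/
def PklUnbdd (κ lam : Cardinal) (U : Set (Set Ordinal)) : Prop :=
  U ⊆ Pkl κ lam ∧ ∀ x ∈ Pkl κ lam, ∃ y ∈ U, x ⊆ y

/-- `A` is covering: `⋃ A = λ`. -/
def PklCovering (lam : Cardinal) (A : Set (Set Ordinal)) : Prop :=
  ∀ ξ < lam.ord, ∃ x ∈ A, ξ ∈ x

/-- A `P_κλ`-list `d` splits every unbounded subset of `P_κλ` into covering sets iff `d`
does not cohere on an unbounded set with a continuous delay function: there are no
`B ⊆ λ`, unbounded `U ⊆ P_κλ` and `g : λ → λ` such that for every `x ∈ P_κλ` and every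
`y ∈ U` with `x ∪ g[x] ⊆ y`, `B ∩ x = d_y ∩ x`. -/
theorem pkl_splits_covering_iff_no_continuous_delay_coherence (κ lam : Cardinal)
    (hκ : ℵ₀ < κ) (hreg : κ.IsRegular) (hkl : κ ≤ lam)
    (d : Set Ordinal → Set Ordinal) (hd : ∀ x ∈ Pkl κ lam, d x ⊆ x) :
    (∀ A, PklUnbdd κ lam A → ∃ β < lam.ord,
        PklCovering lam {x | x ∈ A ∧ β ∈ d x} ∧
        PklCovering lam {x | x ∈ A ∧ β ∈ x ∧ β ∉ d x}) ↔
      ¬ ∃ B : Set Ordinal, B ⊆ Set.Iio lam.ord ∧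
          ∃ U, PklUnbdd κ lam U ∧
            ∃ g : Ordinal → Ordinal, (∀ ξ < lam.ord, g ξ < lam.ord) ∧
              ∀ x ∈ Pkl κ lam, ∀ y ∈ U, x ∪ g '' x ⊆ y → B ∩ x = d y ∩ x := by
  constructor
  · rintro hsplit ⟨B, -, U, hU, g, hg, hcoh⟩
    obtain ⟨β, hβ, hpos, hneg⟩ := hsplit U hU
    have hmem : ({β} : Set Ordinal) ∈ Pkl κ lam := by
      refine ⟨by simpa using hβ, ?_⟩
      rw [Cardinal.mk_singleton, Cardinal.one_lt_lift_iff]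
      exact Cardinal.one_lt_aleph0.trans hκ
    have key : ∀ y ∈ U, β ∈ y → g β ∈ y → (β ∈ B ↔ β ∈ d y) := by
      intro y hy hβy hgy
      have h := hcoh {β} hmem y hy (by simp [Set.insert_subset_iff, hβy, hgy])
      simpa using Set.ext_iff.1 h β
    obtain ⟨y, ⟨hyU, hyd⟩, hgy⟩ := hpos (g β) (hg β hβ)
    obtain ⟨z, ⟨hzU, hβz, hzd⟩, hgz⟩ := hneg (g β) (hg β hβ)
    exact hzd ((key z hzU hβz hgz).1 ((key y hyU (hd y (hU.1 hyU) hyd) hgy).2 hyd))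
  · intro hcoh A hA
    by_contra! hsplit
    have hwit : ∀ β, ∃ γ, β < lam.ord → γ < lam.ord ∧
        ((∀ y ∈ A, β ∈ y → γ ∈ y → β ∈ d y) ∨ (∀ y ∈ A, γ ∈ y → β ∉ d y)) := by
      intro β
      by_cases hβ : β < lam.ord
      · by_cases hpos : PklCovering lam {x | x ∈ A ∧ β ∈ d x}
        · have hneg := hsplit β hβ hpos
          simp only [PklCovering, not_forall] at hneg
          obtain ⟨γ, hγ, hnot⟩ := hneg
          refine ⟨γ, fun _ => ⟨hγ, Or.inl fun y hy hβy hγy => ?_⟩⟩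
          by_contra hyd
          exact hnot ⟨y, ⟨hy, hβy, hyd⟩, hγy⟩
        · simp only [PklCovering, not_forall] at hpos
          obtain ⟨γ, hγ, hnot⟩ := hpos
          exact ⟨γ, fun _ => ⟨hγ, Or.inr fun y hy hγy hyd => hnot ⟨y, ⟨hy, hyd⟩, hγy⟩⟩⟩
      · exact ⟨0, fun h => absurd h hβ⟩
    choose g hg using hwit
    refine hcoh ⟨{β | β < lam.ord ∧ ∀ y ∈ A, β ∈ y → g β ∈ y → β ∈ d y}, fun β h => h.1,
      A, hA, g, fun ξ hξ => (hg ξ hξ).1, fun x hx y hy hxy => ?_⟩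
    ext β
    refine and_congr_left fun hβx => ?_
    have hβy : β ∈ y := hxy (Or.inl hβx)
    have hgy : g β ∈ y := hxy (Or.inr (Set.mem_image_of_mem g hβx))
    have hβ : β < lam.ord := hx.1 hβx
    refine ⟨fun h => h.2 y hy hβy hgy, fun hyd => ⟨hβ, ?_⟩⟩
    exact (hg β hβ).2.resolve_right fun h => h y hy hgy hyd
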